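/- Fix n ≥ 1 and r with n+1 ≤ r ≤ (n+1)(n+2)/2, and let c be the smallest integer with r ≤ Σ_{j=0}^c (n−j+1). For a format (N, R) with N ∈ {n, n+1}, let B₂^{(N,R)} be the set of the first R − (N+1) degree-2 exponent vectors e_a + e_b (1 ≤ a ≤ b ≤ N) in graded lexicographic order (i.e., ordered by the pairs (a,b) lexicographically: (1,1),(1,2),…,(1,N),(2,2),…), and define Y^{(N,R)} := { α+α'+e_i : α, α' ∈ B₂^{(N,R)}, 1 ≤ i ≤ N }, E₁^{(N,R)} := { (α+e_i, β+e_j) : α ∈ B₂^{(N,R)}, β ∈ {e_1,…,e_N}, i ≠ j, β+e_j ∉ B₂^{(N,R)}, β+e_i ∈ B₂^{(N,R)} }, and E₂^{(N,R)} := { unordered pairs {(α+e_i, β+e_j), (α+e_j, β+e_i)} : α, β ∈ B₂^{(N,R)} resp. β ∈ {e_1,…,e_N}, i < j, β+e_i ∉ B₂^{(N,R)}, β+e_j ∉ B₂^{(N,R)} }, with E^{(N,R)} the disjoint union of E₁^{(N,R)} and E₂^{(N,R)}. If |E^{(n,r)}| ≥ |Y^{(n,r)}| then |E^{(n+1, r+c)}|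 ≥ |Y^{(n+1, r+c)}|. -/

import Mathlib

open scoped BigOperators

/-- The 0-indexed position of the pair `(a,b)` (with `a ≤ b`) in the lexicographic
ordering of pairs `(a',b')` with `a' ≤ b'`. -/
def pairPos (N : ℕ) (a b : Fin N) : ℕ :=
  (Finset.univ.filter
    (fun p : Fin N × Fin N => p.1 ≤ p.2 ∧ (p.1 < a ∨ (p.1 = a ∧ p.2 < b)))).card

/-- The degree-2 part `B₂^{(N,R)}`: the first `R − (N+1)` degree-2 exponent vectors
`e_a + e_b` (`a ≤ b`) in graded lexicographic order. -/
def B2 (N R : ℕ) : Set (Fin N → ℕ) :=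
  {γ | ∃ a b : Fin N, a ≤ b ∧ pairPos N a b < R - (N+1) ∧
        γ = Pi.single a 1 + Pi.single b 1}

/-- The set `Y^{(N,R)}` of moment variables. -/
def Yset (N R : ℕ) : Set (Fin N → ℕ) :=
  {γ | ∃ α ∈ B2 N R, ∃ α' ∈ B2 N R, ∃ i : Fin N, γ = α + α' + Pi.single i 1}

/-- The index set `E₁^{(N,R)}` of linear determinantal relations. -/
def E1set (N R : ℕ) : Set ((Fin N → ℕ) × (Fin N → ℕ)) :=
  {q | ∃ α ∈ B2 N R, ∃ b i j : Fin N, i ≠ j ∧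
        Pi.single b 1 + Pi.single j 1 ∉ B2 N R ∧
        Pi.single b 1 + Pi.single i 1 ∈ B2 N R ∧
        q = (α + Pi.single i 1, Pi.single b 1 + Pi.single j 1)}

/-- The index set `E₂^{(N,R)}` of the remaining linear determinantal relations, each
recorded by its canonical representative with `i < j`. -/
def E2set (N R : ℕ) :
    Set (((Fin N → ℕ) × (Fin N → ℕ)) × ((Fin N → ℕ) × (Fin N → ℕ))) :=
  {q | ∃ α ∈ B2 N R, ∃ b i j : Fin N, i < j ∧
        Pi.single b 1 + Pi.single i 1 ∉ B2 N R ∧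
        Pi.single b 1 + Pi.single j 1 ∉ B2 N R ∧
        q = ((α + Pi.single i 1, Pi.single b 1 + Pi.single j 1),
             (α + Pi.single j 1, Pi.single b 1 + Pi.single i 1))}

lemma card_piAnti (α : Type*) [Fintype α] [DecidableEq α] (n : ℕ) :
    (Finset.piAntidiag (Finset.univ : Finset α) n).card = (Fintype.card α).multichoose n := by
  rw [← Sym.card_sym_eq_multichoose, ← Nat.card_eq_fintype_card,
    Nat.card_congr (Sym.equivNatSumOfFintype α n)]
  rw [← Fintype.card_coe, ← Nat.card_eq_fintype_card]
  exact Nat.card_congr (Equiv.subtypeEquivRight (by simp))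

/-- degree vector -/
def dg {ι : Type*} [Fintype ι] (κ : ι → Fin 4) (γ : ι → ℕ) : Fin 4 → ℕ :=
  fun c => ∑ i, if κ i = c then γ i else 0

section
set_option linter.unusedSectionVars false
variable {ι : Type*} [Fintype ι] [DecidableEq ι] (κ : ι → Fin 4)

lemma dg_add (x y : ι → ℕ) : dg κ (x + y) = dg κ x + dg κ y := by
  funext c
  simp only [dg, Pi.add_apply, ← Finset.sum_add_distrib]
  refine Finset.sum_congr rfl fun i _ => ?_
  split_ifs <;> simp

lemma dg_single (i : ι) : dg κ (Pi.single i 1) = Pi.single (κ i) 1 := by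
  funext c
  simp only [dg]
  rw [Finset.sum_eq_single i]
  · by_cases h : κ i = c
    · subst h; simp
    · simp [h]
  · intro j _ hj; simp [hj]
  · simp

lemma dg_lift (γ : ι → ℕ) (v : Fin 4 → ℕ) (c : Fin 4) (h : dg κ γ = v + Pi.single c 1) :
    ∃ i γ', κ i = c ∧ γ = γ' + Pi.single i 1 ∧ dg κ γ' = v := by
  have h1 : dg κ γ c ≠ 0 := by rw [h]; simp
  obtain ⟨i, -, hi⟩ := Finset.exists_ne_zero_of_sum_ne_zero h1
  have hk : κ i = c := by by_contra hh; simp [hh] at hi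
  have hg : γ i ≠ 0 := by simpa [hk] using hi
  have e : γ = (γ - Pi.single i 1) + Pi.single i 1 := by
    funext j
    by_cases hj : j = i
    · subst hj; simp; omega
    · simp [hj]
  refine ⟨i, γ - Pi.single i 1, hk, e, ?_⟩
  have := dg_add κ (γ - Pi.single i 1) (Pi.single i 1)
  rw [← e, h, dg_single, hk] at this
  exact (add_right_cancel this).symm

lemma dg_zero (γ : ι → ℕ) (h : dg κ γ = 0) : γ = 0 := by
  funext i
  have := congrFun h (κ i)
  simp only [dg, Pi.zero_apply, Finset.sum_eq_zero_iff] at this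
  simpa using this i (Finset.mem_univ _)

/-- monomials of given degree vector -/
def cls (v : Fin 4 → ℕ) : Finset (ι → ℕ) :=
  (Fintype.piFinset (fun c => Finset.piAntidiag (Finset.univ : Finset {i // κ i = c}) (v c))).image
    (fun g i => g (κ i) ⟨i, rfl⟩)

lemma sum_fiber (γ : ι → ℕ) (c : Fin 4) :
    ∑ i : {i // κ i = c}, γ i = dg κ γ c := by
  rw [dg, ← Finset.sum_filter]
  exact (Finset.sum_subtype _ (by simp) _).symm

lemma mem_cls (v : Fin 4 → ℕ) (γ : ι → ℕ) : γ ∈ cls κ v ↔ dg κ γ = v := by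
  simp only [cls, Finset.mem_image, Fintype.mem_piFinset, Finset.mem_piAntidiag]
  constructor
  · rintro ⟨g, hg, rfl⟩
    funext c
    rw [← (hg c).1, ← sum_fiber]
    refine Finset.sum_congr rfl fun i _ => ?_
    obtain ⟨i, rfl⟩ := i
    rfl
  · rintro rfl
    exact ⟨fun c i => γ i, fun c => ⟨sum_fiber κ γ c, by simp⟩, rfl⟩

lemma card_cls (v : Fin 4 → ℕ) :
    (cls κ v).card = ∏ c, (Fintype.card {i // κ i = c}).multichoose (v c) := by
  rw [cls, Finset.card_image_of_injective, Fintype.card_piFinset]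
  · refine Finset.prod_congr rfl fun c _ => ?_
    exact card_piAnti _ _
  · intro g g' h
    funext c i
    obtain ⟨i, rfl⟩ := i
    exact congrFun h i
end

lemma mc2 (n : ℕ) : (Nat.multichoose n 2 : ℚ) = n*(n+1)/2 := by
  induction n with
  | zero => simp
  | succ n ih => rw [Nat.multichoose_succ_succ]; push_cast; rw [ih]; simp; ring
lemma mc3 (n : ℕ) : (Nat.multichoose n 3 : ℚ) = n*(n+1)*(n+2)/6 := by
  induction n with
  | zero => simp
  | succ n ih => rw [Nat.multichoose_succ_succ]; push_cast; rw [ih, mc2]; push_cast; ring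
lemma mc4 (n : ℕ) : (Nat.multichoose n 4 : ℚ) = n*(n+1)*(n+2)*(n+3)/24 := by
  induction n with
  | zero => simp
  | succ n ih => rw [Nat.multichoose_succ_succ]; push_cast; rw [ih, mc3]; push_cast; ring
lemma mc5 (n : ℕ) : (Nat.multichoose n 5 : ℚ) = n*(n+1)*(n+2)*(n+3)*(n+4)/120 := by
  induction n with
  | zero => simp
  | succ n ih => rw [Nat.multichoose_succ_succ]; push_cast; rw [ih, mc4]; push_cast; ring

/-- colour version of membership of a quadratic monomial -/
def gc (a b : Fin 4) : Bool :=
  a == 0 || b == 0 || (a == 1 && (b == 1 || b == 2)) || (b == 1 && a == 2)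

/-- unit degree vector -/
def un (c : Fin 4) : Fin 4 → ℕ := Pi.single c 1

def VB : Finset (Fin 4 → ℕ) :=
  (Finset.univ.filter (fun p : Fin 4 × Fin 4 => gc p.1 p.2)).image (fun p => un p.1 + un p.2)

def VY : Finset (Fin 4 → ℕ) :=
  (Finset.univ.filter (fun p : (Fin 4 × Fin 4) × (Fin 4 × Fin 4) × Fin 4 =>
    gc p.1.1 p.1.2 ∧ gc p.2.1.1 p.2.1.2)).image
    (fun p => (un p.1.1 + un p.1.2) + (un p.2.1.1 + un p.2.1.2) + un p.2.2)

def VE : Finset ((Fin 4 → ℕ) × (Fin 4 → ℕ)) :=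
  (Finset.univ.filter (fun p : (Fin 4 × Fin 4) × (Fin 4 × Fin 4 × Fin 4) =>
    gc p.1.1 p.1.2 ∧ ¬ gc p.2.1 p.2.2.2 ∧ gc p.2.1 p.2.2.1)).image
    (fun p => ((un p.1.1 + un p.1.2) + un p.2.2.1, un p.2.1 + un p.2.2.2))

def LB : List (Fin 4 → ℕ) :=
  [
    ![0, 1, 1, 0], ![0, 2, 0, 0], ![1, 0, 0, 1], ![1, 0, 1, 0], ![1, 1, 0, 0], ![2, 0, 0, 0]]

def LY : List (Fin 4 → ℕ) :=
  [
    ![0, 2, 2, 1], ![0, 2, 3, 0], ![0, 3, 1, 1], ![0, 3, 2, 0], ![0, 4, 0, 1], ![0, 4, 1, 0],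
    ![0, 5, 0, 0], ![1, 1, 1, 2], ![1, 1, 2, 1], ![1, 1, 3, 0], ![1, 2, 0, 2], ![1, 2, 1, 1],
    ![1, 2, 2, 0], ![1, 3, 0, 1], ![1, 3, 1, 0], ![1, 4, 0, 0], ![2, 0, 0, 3], ![2, 0, 1, 2],
    ![2, 0, 2, 1], ![2, 0, 3, 0], ![2, 1, 0, 2], ![2, 1, 1, 1], ![2, 1, 2, 0], ![2, 2, 0, 1],
    ![2, 2, 1, 0], ![2, 3, 0, 0], ![3, 0, 0, 2], ![3, 0, 1, 1], ![3, 0, 2, 0], ![3, 1, 0, 1],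
    ![3, 1, 1, 0], ![3, 2, 0, 0], ![4, 0, 0, 1], ![4, 0, 1, 0], ![4, 1, 0, 0], ![5, 0, 0, 0]]

def LF : List ((Fin 4 → ℕ) × (Fin 4 → ℕ)) :=
  [
    (![0, 1, 2, 0], ![0, 1, 0, 1]), (![0, 2, 1, 0], ![0, 0, 1, 1]),
    (![0, 2, 1, 0], ![0, 0, 2, 0]), (![0, 2, 1, 0], ![0, 1, 0, 1]),
    (![0, 3, 0, 0], ![0, 0, 1, 1]), (![0, 3, 0, 0], ![0, 0, 2, 0]),
    (![0, 3, 0, 0], ![0, 1, 0, 1]), (![1, 0, 1, 1], ![0, 1, 0, 1]),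
    (![1, 0, 2, 0], ![0, 1, 0, 1]), (![1, 1, 0, 1], ![0, 0, 1, 1]),
    (![1, 1, 0, 1], ![0, 0, 2, 0]), (![1, 1, 0, 1], ![0, 1, 0, 1]),
    (![1, 1, 1, 0], ![0, 0, 0, 2]), (![1, 1, 1, 0], ![0, 0, 1, 1]),
    (![1, 1, 1, 0], ![0, 0, 2, 0]), (![1, 1, 1, 0], ![0, 1, 0, 1]),
    (![1, 2, 0, 0], ![0, 0, 0, 2]), (![1, 2, 0, 0], ![0, 0, 1, 1]),
    (![1, 2, 0, 0], ![0, 0, 2, 0]), (![1, 2, 0, 0], ![0, 1, 0, 1]),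
    (![2, 0, 0, 1], ![0, 0, 0, 2]), (![2, 0, 0, 1], ![0, 0, 1, 1]),
    (![2, 0, 0, 1], ![0, 0, 2, 0]), (![2, 0, 0, 1], ![0, 1, 0, 1]),
    (![2, 0, 1, 0], ![0, 0, 0, 2]), (![2, 0, 1, 0], ![0, 0, 1, 1]),
    (![2, 0, 1, 0], ![0, 0, 2, 0]), (![2, 0, 1, 0], ![0, 1, 0, 1]),
    (![2, 1, 0, 0], ![0, 0, 0, 2]), (![2, 1, 0, 0], ![0, 0, 1, 1]),
    (![2, 1, 0, 0], ![0, 0, 2, 0]), (![2, 1, 0, 0], ![0, 1, 0, 1]),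
    (![3, 0, 0, 0], ![0, 0, 0, 2]), (![3, 0, 0, 0], ![0, 0, 1, 1]),
    (![3, 0, 0, 0], ![0, 0, 2, 0]), (![3, 0, 0, 0], ![0, 1, 0, 1])]

lemma VB_eq : VB = LB.toFinset := by decide +kernel
lemma VY_eq : VY = LY.toFinset := by decide +kernel
lemma VE_eq : VE = LF.toFinset := by decide +kernel
lemma LB_nodup : LB.Nodup := by decide +kernel
lemma LY_nodup : LY.Nodup := by decide +kernel
lemma LF_nodup : LF.Nodup := by decide +kernel

/-- fibre sizes -/
def fs (k t u : ℕ) : Fin 4 → ℕ := ![k, 1, t, u]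

/-- number of monomials of given degree vector -/
def nm (k t u : ℕ) (v : Fin 4 → ℕ) : ℕ := ∏ c, (fs k t u c).multichoose (v c)


lemma mc0 (n : ℕ) : (Nat.multichoose n 0 : ℚ) = 1 := by simp
lemma mc1 (n : ℕ) : (Nat.multichoose n 1 : ℚ) = n := by simp

lemma nm_vec (k t u a b c d : ℕ) : nm k t u ![a, b, c, d] =
    k.multichoose a * t.multichoose c * u.multichoose d := by
  simp [nm, fs, Fin.prod_univ_four, Nat.multichoose_one]

lemma sumB (k t u : ℕ) : ((∑ v ∈ VB, nm k t u v : ℕ) : ℚ) =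
    k * (t+1+u) + k*(k+1)/2 + t + 1 := by
  rw [VB_eq, List.sum_toFinset _ LB_nodup]
  simp only [LB, List.map_cons, List.map_nil, List.sum_cons, List.sum_nil, nm_vec]
  push_cast
  simp only [mc0, mc1, mc2]
  ring

/-- binomial polynomials -/
def c2 (x : ℚ) : ℚ := x*(x-1)/2
def c3 (x : ℚ) : ℚ := x*(x-1)*(x-2)/6
def c4 (x : ℚ) : ℚ := x*(x-1)*(x-2)*(x-3)/24
def c5 (x : ℚ) : ℚ := x*(x-1)*(x-2)*(x-3)*(x-4)/120

def pY (k t u : ℚ) : ℚ :=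
  c5 (k+4) + c4 (k+3) * (t+u) + c3 (k+2) * c2 (t+u+1) + c2 (k+1) * c3 (t+u+2)
    + k * (c3 (t+u+2) - c3 (u+2)) + c3 (t+2) + c2 (t+1) * u

def pE1 (k t u : ℚ) : ℚ :=
  u * (c3 (k+2) + c2 (k+1) * (t+u) + k * (c2 (t+u+1) - c2 (u+1)) + c2 (t+1))
    + (c2 (t+u) - c2 (u+1)) * (c3 (k+2) + c2 (k+1) * (t+u) + k * (t+u) + t)
    + c2 (u+1) * (c3 (k+2) + c2 (k+1) * (t+u) + k * t)

def pE2 (k t u : ℚ) : ℚ :=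
  (k * (t+u) + c2 (k+1) + t) * (c2 u + (t-1) * c2 (t+u-1) + u * c2 (t+u))

lemma sumY (k t u : ℕ) : ((∑ v ∈ VY, nm k t u v : ℕ) : ℚ) = pY k (t+1) u := by
  rw [VY_eq, List.sum_toFinset _ LY_nodup]
  simp only [LY, List.map_cons, List.map_nil, List.sum_cons, List.sum_nil, nm_vec]
  push_cast
  simp only [mc0, mc1, mc2, mc3, mc4, mc5, pY, c2, c3, c4, c5]
  ring

lemma sumE (k t u : ℕ) :
    ((∑ v ∈ VE, nm k t u v.1 * nm k t u v.2 : ℕ) : ℚ) = pE1 k (t+1) u := by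
  rw [VE_eq, List.sum_toFinset _ LF_nodup]
  simp only [LF, List.map_cons, List.map_nil, List.sum_cons, List.sum_nil, nm_vec]
  push_cast
  simp only [mc0, mc1, mc2, mc3, pE1, c2, c3]
  ring

/-- difference of relations and variables -/
def pF (k t u : ℚ) : ℚ := pE1 k t u + pE2 k t u - pY k t u

lemma pF_step (k t u : ℚ) (hk : 0 ≤ k) (ht : 0 ≤ t) (hu : 0 ≤ u) (h : 0 ≤ pF k (t+1) u) :
    0 ≤ pF k (t+1) (u+1) := by
  have key : 0 ≤ 120 * ((t+u+1) * (pF k (t+1) (u+1) - pF k (t+1) u) - pF k (t+1) u) := by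
    have : 120 * ((t+u+1) * (pF k (t+1) (u+1) - pF k (t+1) u) - pF k (t+1) u) = 
        1*k^5 + 10*k^4 + 20*k^3*t + 55*k^3 + 100*k^2*t^3 + 300*k^2*t^2*u + 390*k^2*t^2
        + 300*k^2*t*u^2 + 840*k^2*t*u + 470*k^2*t + 100*k^2*u^3 + 420*k^2*u^2 + 560*k^2*u
        + 290*k^2 + 180*k*t^4 + 720*k*t^3*u + 960*k*t^3 + 1080*k*t^2*u^2 + 3180*k*t^2*u
        + 2010*k*t^2 + 720*k*t*u^3 + 3180*k*t*u^2 + 4560*k*t*u + 1870*k*t + 180*k*u^4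
        + 1060*k*u^3 + 2280*k*u^2 + 2120*k*u + 724*k + 120*t^4 + 360*t^3*u + 620*t^3
        + 360*t^2*u^2 + 1320*t^2*u + 960*t^2 + 120*t*u^3 + 840*t*u^2 + 1560*t*u + 700*t
        + 120*u^3 + 480*u^2 + 600*u + 240 := by
      simp only [pF, pY, pE1, pE2, c2, c3, c4, c5]
      ring
    rw [this]
    positivity
  have h1 : 0 ≤ (t+u+1) * (pF k (t+1) (u+1) - pF k (t+1) u) := by linarith
  have h2 : 0 ≤ pF k (t+1) (u+1) - pF k (t+1) u :=
    nonneg_of_mul_nonneg_right h1 (by positivity)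
  linarith
lemma sg_inj {N : ℕ} {a b : Fin N} (h : (Pi.single a 1 : Fin N → ℕ) = Pi.single b 1) : a = b := by
  by_contra hne
  have := congrFun h a
  simp [hne] at this


lemma cls_card' {N : ℕ} (κ : Fin N → Fin 4) (k t u : ℕ)
    (hc : ∀ c, Fintype.card {i // κ i = c} = fs k t u c) (v : Fin 4 → ℕ) :
    (cls κ v).card = nm k t u v := by
  rw [card_cls, nm]
  exact Finset.prod_congr rfl fun c _ => by rw [hc]

lemma ncard_V {N : ℕ} (κ : Fin N → Fin 4) (k t u : ℕ)
    (hc : ∀ c, Fintype.card {i // κ i = c} = fs k t u c) (V : Finset (Fin 4 → ℕ)) :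
    {γ | dg κ γ ∈ V}.ncard = ∑ v ∈ V, nm k t u v := by
  have : {γ | dg κ γ ∈ V} = ((V.biUnion (cls κ) : Finset (Fin N → ℕ)) : Set (Fin N → ℕ)) := by
    ext γ; simp [mem_cls]
  rw [this, Set.ncard_coe_finset, Finset.card_biUnion]
  · exact Finset.sum_congr rfl fun v _ => cls_card' κ k t u hc v
  · intro x _ y _ hxy
    rw [Function.onFun, Finset.disjoint_left]
    intro γ h1 h2
    rw [mem_cls] at h1 h2
    exact hxy (h1.symm.trans h2)

lemma ncard_VV {N : ℕ} (κ : Fin N → Fin 4) (k t u : ℕ)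
    (hc : ∀ c, Fintype.card {i // κ i = c} = fs k t u c)
    (V : Finset ((Fin 4 → ℕ) × (Fin 4 → ℕ))) :
    {q : (Fin N → ℕ) × (Fin N → ℕ) | (dg κ q.1, dg κ q.2) ∈ V}.ncard
      = ∑ v ∈ V, nm k t u v.1 * nm k t u v.2 := by
  have : {q : (Fin N → ℕ) × (Fin N → ℕ) | (dg κ q.1, dg κ q.2) ∈ V} =
      ((V.biUnion (fun v => cls κ v.1 ×ˢ cls κ v.2) :
        Finset ((Fin N → ℕ) × (Fin N → ℕ))) : Set ((Fin N → ℕ) × (Fin N → ℕ))) := by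
    ext q; simp [mem_cls]
  rw [this, Set.ncard_coe_finset, Finset.card_biUnion]
  · refine Finset.sum_congr rfl fun v _ => ?_
    rw [Finset.card_product, cls_card' κ k t u hc, cls_card' κ k t u hc]
  · intro x _ y _ hxy
    rw [Function.onFun, Finset.disjoint_left]
    intro γ h1 h2
    rw [Finset.mem_product, mem_cls, mem_cls] at h1 h2
    exact hxy (Prod.ext (h1.1.symm.trans h2.1) (h1.2.symm.trans h2.2))

lemma lift2 {N : ℕ} (κ : Fin N → Fin 4) (γ : Fin N → ℕ) (a b : Fin 4)
    (h : dg κ γ = un a + un b) :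
    ∃ i j, κ i = a ∧ κ j = b ∧ γ = Pi.single i 1 + Pi.single j 1 := by
  obtain ⟨j, γ', hj, rfl, h'⟩ := dg_lift κ γ _ _ h
  obtain ⟨i, γ'', hi, rfl, h''⟩ := dg_lift κ γ' 0 a (by rw [h', zero_add]; rfl)
  rw [dg_zero κ _ h'', zero_add]
  exact ⟨i, j, hi, hj, rfl⟩

lemma lift3 {N : ℕ} (κ : Fin N → Fin 4) (γ : Fin N → ℕ) (a b c : Fin 4)
    (h : dg κ γ = un a + un b + un c) :
    ∃ i j l, κ i = a ∧ κ j = b ∧ κ l = c ∧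
      γ = Pi.single i 1 + Pi.single j 1 + Pi.single l 1 := by
  obtain ⟨l, γ', hl, rfl, h'⟩ := dg_lift κ γ _ _ h
  obtain ⟨i, j, hi, hj, rfl⟩ := lift2 κ γ' a b h'
  exact ⟨i, j, l, hi, hj, hl, rfl⟩

lemma lift5 {N : ℕ} (κ : Fin N → Fin 4) (γ : Fin N → ℕ) (a b c d e : Fin 4)
    (h : dg κ γ = (un a + un b) + (un c + un d) + un e) :
    ∃ i j l m o, κ i = a ∧ κ j = b ∧ κ l = c ∧ κ m = d ∧ κ o = e ∧
      γ = (Pi.single i 1 + Pi.single j 1) + (Pi.single l 1 + Pi.single m 1) + Pi.single o 1 := by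
  obtain ⟨o, γ', ho, rfl, h'⟩ := dg_lift κ γ _ _ h
  rw [← add_assoc] at h'
  obtain ⟨m, γ'', hm, rfl, h''⟩ := dg_lift κ γ' _ _ h'
  obtain ⟨i, j, l, hi, hj, hl, rfl⟩ := lift3 κ γ'' a b c h''
  exact ⟨i, j, l, m, o, hi, hj, hl, hm, ho, by rw [← add_assoc]⟩

lemma dg_two {N : ℕ} (κ : Fin N → Fin 4) (a b : Fin N) :
    dg κ (Pi.single a 1 + Pi.single b 1) = un (κ a) + un (κ b) := by
  rw [dg_add, dg_single, dg_single]; rfl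

lemma B2_form {N R : ℕ} {α : Fin N → ℕ} (h : α ∈ B2 N R) :
    ∃ a b : Fin N, α = Pi.single a 1 + Pi.single b 1 := by
  obtain ⟨a, b, -, -, h⟩ := h
  exact ⟨a, b, h⟩

section sets
variable {N R : ℕ} (κ : Fin N → Fin 4)

lemma B2_eq (hB : ∀ a b : Fin N,
      (Pi.single a 1 + Pi.single b 1 : Fin N → ℕ) ∈ B2 N R ↔ gc (κ a) (κ b) = true) :
    B2 N R = {γ | dg κ γ ∈ VB} := by
  ext γ
  simp only [Set.mem_ofPred_eq, VB, Finset.mem_image, Finset.mem_filter, Finset.mem_univ, true_and]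
  constructor
  · intro h
    obtain ⟨a, b, rfl⟩ := B2_form h
    exact ⟨(κ a, κ b), (hB a b).1 h, (dg_two κ a b).symm⟩
  · rintro ⟨⟨a, b⟩, h, h'⟩
    obtain ⟨i, j, rfl, rfl, rfl⟩ := lift2 κ γ a b h'.symm
    exact (hB i j).2 h

lemma Y_eq (hB : ∀ a b : Fin N,
      (Pi.single a 1 + Pi.single b 1 : Fin N → ℕ) ∈ B2 N R ↔ gc (κ a) (κ b) = true) :
    Yset N R = {γ | dg κ γ ∈ VY} := by
  ext γ
  simp only [Yset, Set.mem_ofPred_eq, VY, Finset.mem_image, Finset.mem_filter, Finset.mem_univ,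
    true_and]
  constructor
  · rintro ⟨α, h, α', h', i, rfl⟩
    obtain ⟨a, b, rfl⟩ := B2_form h
    obtain ⟨c, d, rfl⟩ := B2_form h'
    refine ⟨((κ a, κ b), (κ c, κ d), κ i), ⟨(hB a b).1 h, (hB c d).1 h'⟩, ?_⟩
    rw [dg_add, dg_add, dg_two, dg_two, dg_single]; rfl
  · rintro ⟨⟨⟨a, b⟩, ⟨c, d⟩, e⟩, ⟨h, h'⟩, h''⟩
    obtain ⟨i, j, l, m, o, rfl, rfl, rfl, rfl, rfl, rfl⟩ := lift5 κ γ a b c d e h''.symm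
    exact ⟨_, (hB i j).2 h, _, (hB l m).2 h', o, rfl⟩

lemma E1_eq (hB : ∀ a b : Fin N,
      (Pi.single a 1 + Pi.single b 1 : Fin N → ℕ) ∈ B2 N R ↔ gc (κ a) (κ b) = true) :
    E1set N R = {q | (dg κ q.1, dg κ q.2) ∈ VE} := by
  ext ⟨x, y⟩
  simp only [E1set, Set.mem_ofPred_eq, VE, Finset.mem_image, Finset.mem_filter, Finset.mem_univ,
    true_and]
  constructor
  · rintro ⟨α, h, b, i, j, hij, h1, h2, h3⟩
    obtain ⟨a, c, rfl⟩ := B2_form h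
    obtain ⟨rfl, rfl⟩ := Prod.mk.inj h3
    refine ⟨((κ a, κ c), (κ b, κ i, κ j)), ⟨(hB a c).1 h, fun hh => h1 ((hB b j).2 hh),
      (hB b i).1 h2⟩, ?_⟩
    rw [dg_add, dg_two, dg_two, dg_single]; rfl
  · rintro ⟨⟨⟨a, c⟩, b, i, j⟩, ⟨h, h1, h2⟩, h3⟩
    obtain ⟨h4, h5⟩ := Prod.mk.inj h3
    obtain ⟨b', j', rfl, rfl, rfl⟩ := lift2 κ y b j h5.symm
    obtain ⟨a', c', i', rfl, rfl, rfl, rfl⟩ := lift3 κ x a c i h4.symm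
    simp only at h h1 h2
    refine ⟨_, (hB a' c').2 h, b', i', j', ?_, fun hh => h1 ((hB b' j').1 hh),
      (hB b' i').2 h2, rfl⟩
    rintro rfl
    exact h1 h2

/-- triples indexing the second kind of relations -/
def trip : Finset (Fin N × Fin N × Fin N) :=
  Finset.univ.filter (fun p => p.2.1 < p.2.2 ∧ ¬ gc (κ p.1) (κ p.2.1) ∧ ¬ gc (κ p.1) (κ p.2.2))

lemma E2_card (hB : ∀ a b : Fin N,
      (Pi.single a 1 + Pi.single b 1 : Fin N → ℕ) ∈ B2 N R ↔ gc (κ a) (κ b) = true) :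
    (E2set N R).ncard = (B2 N R).ncard * (trip κ).card := by
  have : E2set N R = Set.image (fun p : (Fin N → ℕ) × (Fin N × Fin N × Fin N) =>
      ((p.1 + Pi.single p.2.2.1 1, (Pi.single p.2.1 1 + Pi.single p.2.2.2 1 : Fin N → ℕ)),
       (p.1 + Pi.single p.2.2.2 1, (Pi.single p.2.1 1 + Pi.single p.2.2.1 1 : Fin N → ℕ))))
       (B2 N R ×ˢ (trip κ : Set (Fin N × Fin N × Fin N))) := by
    ext q
    simp only [E2set, Set.mem_ofPred_eq, Set.mem_image, Set.mem_prod, Finset.mem_coe, trip,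
      Finset.mem_filter, Finset.mem_univ, true_and, hB]
    constructor
    · rintro ⟨α, h, b, i, j, h1, h2, h3, rfl⟩
      exact ⟨(α, b, i, j), ⟨h, h1, h2, h3⟩, rfl⟩
    · rintro ⟨⟨α, b, i, j⟩, ⟨h, h1, h2, h3⟩, rfl⟩
      exact ⟨α, h, b, i, j, h1, h2, h3, rfl⟩
  rw [this, Set.InjOn.ncard_image, Set.ncard_prod, Set.ncard_coe_finset]
  rintro ⟨α, b, i, j⟩ ⟨-, h⟩ ⟨α', b', i', j'⟩ ⟨-, h'⟩ he
  simp only [trip, Finset.mem_coe, Finset.mem_filter, Finset.mem_univ, true_and] at h h'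
  simp only [Prod.mk.injEq] at he
  obtain ⟨⟨e1, e2⟩, e3, e4⟩ := he
  have hij : i ≠ j := h.1.ne
  have hij' : i' ≠ j' := h'.1.ne
  have f1 := congrFun e1
  have f3 := congrFun e3
  simp only [Pi.add_apply] at f1 f3
  have hi : i = i' := by
    by_contra hne
    have g1 := f1 i
    have g3 := f3 i
    simp [hne, hij] at g1 g3
    omega
  subst hi
  have hα : α = α' := add_right_cancel e1
  subst hα
  have hb : b = b' := sg_inj (add_right_cancel e4)
  subst hb
  have hj : j = j' := sg_inj (add_left_cancel e2)
  subst hj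
  rfl

end sets

lemma sum_col {N : ℕ} (κ : Fin N → Fin 4) (k t u : ℕ)
    (hc : ∀ c, Fintype.card {i // κ i = c} = fs k t u c) (F : Fin 4 → ℚ) :
    ∑ i, F (κ i) = ∑ c, (fs k t u c : ℚ) * F c := by
  rw [← Finset.sum_fiberwise Finset.univ κ]
  refine Finset.sum_congr rfl fun c _ => ?_
  rw [← hc c, Fintype.card_subtype, ← nsmul_eq_mul, ← Finset.sum_const]
  refine Finset.sum_congr rfl fun i hi => ?_
  rw [(Finset.mem_filter.1 hi).2]

lemma card_lt_pairs {N : ℕ} (D : Finset (Fin N)) :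
    2 * ((D ×ˢ D).filter (fun p => p.1 < p.2)).card + D.card = D.card * D.card := by
  have h1 : ((D ×ˢ D).filter (fun p => p.2 < p.1)).card
      = ((D ×ˢ D).filter (fun p => p.1 < p.2)).card := by
    refine Finset.card_bij (fun p _ => (p.2, p.1)) ?_ ?_ ?_
    · intro p hp; simp at hp ⊢; tauto
    · rintro ⟨a, b⟩ _ ⟨c, d⟩ _ h; simp at h ⊢; tauto
    · rintro ⟨a, b⟩ hp; refine ⟨(b, a), ?_, rfl⟩; simp at hp ⊢; tauto
  have h2 : D.offDiag = (D ×ˢ D).filter (fun p => p.1 < p.2) ∪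
      (D ×ˢ D).filter (fun p => p.2 < p.1) := by
    ext ⟨a, b⟩
    simp only [Finset.mem_offDiag, Finset.mem_union, Finset.mem_filter, Finset.mem_product]
    have : a ≠ b ↔ a < b ∨ b < a := lt_or_lt_iff_ne.symm
    tauto
  have h3 : Disjoint ((D ×ˢ D).filter (fun p => p.1 < p.2))
      ((D ×ˢ D).filter (fun p => p.2 < p.1)) := by
    rw [Finset.disjoint_left]
    intro p h h'
    exact lt_asymm (Finset.mem_filter.1 h).2 (Finset.mem_filter.1 h').2
  have h4 := Finset.offDiag_card D
  rw [h2, Finset.card_union_of_disjoint h3, h1] at h4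
  have : D.card ≤ D.card * D.card := Nat.le_mul_self _
  omega

lemma trip_card {N : ℕ} (κ : Fin N → Fin 4) (k t u : ℕ)
    (hc : ∀ c, Fintype.card {i // κ i = c} = fs k t u c) :
    ((trip κ).card : ℚ) =
      c2 u + t * c2 (t + u) + u * c2 (t + 1 + u) := by
  let d : Fin 4 → ℚ := fun c => ∑ c', (fs k t u c' : ℚ) * (if gc c c' then 0 else 1)
  have hd : ∀ b, (((Finset.univ.filter (fun i => ¬ gc (κ b) (κ i) = true)).card : ℕ) : ℚ)
      = d (κ b) := by
    intro b
    rw [Finset.card_filter]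
    push_cast
    change _ = ∑ c', (fs k t u c' : ℚ) * (if gc (κ b) c' then 0 else 1)
    rw [← sum_col κ k t u hc (fun c' => if gc (κ b) c' then 0 else 1)]
    refine Finset.sum_congr rfl fun i _ => ?_
    by_cases h : gc (κ b) (κ i) = true <;> simp [h]
  have h1 : ((trip κ).card : ℚ) = ∑ b, c2 (d (κ b)) := by
    rw [trip, Finset.card_filter, Fintype.sum_prod_type]
    push_cast
    refine Finset.sum_congr rfl fun b _ => ?_
    have := card_lt_pairs (Finset.univ.filter (fun i => ¬ gc (κ b) (κ i) = true))
    have h2 : ((((Finset.univ.filter (fun i => ¬ gc (κ b) (κ i) = true)) ×ˢ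
        (Finset.univ.filter (fun i => ¬ gc (κ b) (κ i) = true))).filter
          (fun p => p.1 < p.2)).card : ℚ) =
        ∑ x : Fin N × Fin N, if x.1 < x.2 ∧ ¬ gc (κ b) (κ x.1) = true ∧
          ¬ gc (κ b) (κ x.2) = true then 1 else 0 := by
      rw [← Finset.sum_filter, Finset.sum_const, nsmul_eq_mul, mul_one]
      congr 2
      ext p
      simp only [Finset.mem_filter, Finset.mem_product, Finset.mem_univ, true_and]
      tauto
    rw [← h2]
    have h3 := congrArg (Nat.cast : ℕ → ℚ) this
    push_cast at h3
    rw [← hd b, c2]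
    linarith
  rw [h1, sum_col κ k t u hc (fun c => c2 (d c))]
  simp [Fin.sum_univ_four, d, fs, gc, c2, -mul_eq_mul_left_iff, -mul_eq_mul_right_iff]
  ring

/-- colour of an index -/
def col (k t N : ℕ) (i : Fin N) : Fin 4 :=
  if i.1 < k then 0 else if i.1 = k then 1 else if i.1 < k + 1 + t then 2 else 3

lemma card_fin_filter (N : ℕ) (p : ℕ → Prop) [DecidablePred p] :
    (Finset.univ.filter (fun i : Fin N => p i.1)).card = ((Finset.range N).filter p).card := by
  rw [Finset.card_filter, Finset.card_filter, Finset.sum_range]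

lemma col_card (k t u : ℕ) (c : Fin 4) :
    Fintype.card {i : Fin (k + 1 + t + u) // col k t _ i = c} = fs k t u c := by
  rw [Fintype.card_subtype]
  have aux : ∀ l h : ℕ, h ≤ k + 1 + t + u →
      (∀ i : Fin (k + 1 + t + u), col k t _ i = c ↔ l ≤ i.1 ∧ i.1 < h) →
      (Finset.univ.filter (fun i : Fin (k + 1 + t + u) => col k t _ i = c)).card = h - l := by
    intro l h hh hi
    rw [Finset.filter_congr (fun i _ => hi i), card_fin_filter _ (fun i => l ≤ i ∧ i < h),
      ← Nat.card_Ico]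
    congr 1
    ext x
    simp
    omega
  fin_cases c
  · rw [aux 0 k (by omega) (by
      intro i; simp only [col]; split_ifs <;> simp <;> omega)]
    simp [fs]
  · rw [aux k (k+1) (by omega) (by
      intro i; simp only [col]; split_ifs <;> simp <;> omega)]
    simp [fs]
  · rw [aux (k+1) (k+1+t) (by omega) (by
      intro i; simp only [col]; split_ifs <;> simp <;> omega)]
    simp [fs]
  · rw [aux (k+1+t) (k+1+t+u) (by omega) (by
      intro i; simp only [col]; split_ifs <;> simp <;> omega)]
    simp [fs]

lemma pairPos_eq (N : ℕ) (a b : Fin N) (hab : a ≤ b) :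
    pairPos N a b = ∑ j ∈ Finset.range a.1, (N - j) + (b.1 - a.1) := by
  rw [pairPos, Finset.card_filter, Fintype.sum_prod_type]
  have h1 : ∀ x : Fin N, (∑ y : Fin N, if x ≤ y ∧ (x < a ∨ x = a ∧ y < b) then 1 else 0)
      = (if x.1 < a.1 then N - x.1 else 0) + (if x = a then b.1 - a.1 else 0) := by
    intro x
    rw [← Finset.card_filter]
    rcases lt_trichotomy x a with h | h | h
    · have : Finset.univ.filter (fun y : Fin N => x ≤ y ∧ (x < a ∨ x = a ∧ y < b))
          = Finset.Ici x := by ext y; simp [h]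
      rw [this, Fin.card_Ici]
      simp [h, h.ne]
    · subst h
      have : Finset.univ.filter (fun y : Fin N => x ≤ y ∧ (x < x ∨ x = x ∧ y < b))
          = Finset.Ico x b := by ext y; simp
      rw [this, Fin.card_Ico]
      simp
    · have : Finset.univ.filter (fun y : Fin N => x ≤ y ∧ (x < a ∨ x = a ∧ y < b)) = ∅ := by
        ext y; simp [h.not_gt, h.ne']
      rw [this]
      simp [h.not_gt, h.ne']
  rw [Finset.sum_congr rfl (fun x _ => h1 x), Finset.sum_add_distrib]
  congr 1
  · rw [← Finset.sum_range (fun x => if x < a.1 then N - x else 0), ← Finset.sum_filter]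
    refine Finset.sum_congr ?_ fun _ _ => rfl
    ext x; simp; omega
  · simp

lemma pos_lt (N k t : ℕ) (ht : k + 1 + t ≤ N) (a b : Fin N) (hab : a ≤ b) :
    pairPos N a b < ∑ j ∈ Finset.range k, (N - j) + (t + 1) ↔
      gc (col k t N a) (col k t N b) = true := by
  have hm : ∀ x y : ℕ, x ≤ y → ∑ j ∈ Finset.range x, (N - j) ≤ ∑ j ∈ Finset.range y, (N - j) :=
    fun x y h => Finset.sum_le_sum_of_subset (Finset.range_subset_range.2 h)
  rw [pairPos_eq N a b hab]
  have hab' : a.1 ≤ b.1 := hab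
  have hb := b.2
  rcases lt_trichotomy a.1 k with h | h | h
  · have h1 := hm (a.1+1) k h
    rw [Finset.sum_range_succ] at h1
    have : gc (col k t N a) (col k t N b) = true := by simp [col, h, gc]
    simp only [this, iff_true]
    omega
  · rw [h]
    have ha : col k t N a = 1 := by simp [col, h]
    have : ¬ b.1 < k := by omega
    rw [ha]
    simp only [col, this, if_false]
    split_ifs with h1 h2
    · simp [gc]; omega
    · simp [gc]; omega
    · simp [gc]; omega
  · have h1 := hm (k+1) a.1 h
    rw [Finset.sum_range_succ] at h1
    have : ¬ gc (col k t N a) (col k t N b) = true := by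
      have e1 : ¬ a.1 < k := by omega
      have e2 : ¬ a.1 = k := by omega
      have e3 : ¬ b.1 < k := by omega
      have e4 : ¬ b.1 = k := by omega
      simp only [col, e1, e2, e3, e4, if_false]
      split_ifs <;> simp [gc]
    exact iff_of_false (by omega) this

lemma gc_symm (a b : Fin 4) : gc a b = gc b a := by revert a b; decide

lemma single_pair {N : ℕ} {a b c d : Fin N} (hab : a ≤ b) (hcd : c ≤ d)
    (h : (Pi.single a 1 + Pi.single b 1 : Fin N → ℕ) = Pi.single c 1 + Pi.single d 1) :
    a = c ∧ b = d := by
  have f := congrFun h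
  simp only [Pi.add_apply, Pi.single_apply] at f
  have f1 := f a
  have f2 := f b
  have f3 := f c
  have f4 := f d
  grind

lemma B2_iff (N R k t : ℕ) (ht : k + 1 + t ≤ N)
    (hR : R - (N+1) = ∑ j ∈ Finset.range k, (N - j) + (t + 1)) (a b : Fin N) :
    (Pi.single a 1 + Pi.single b 1 : Fin N → ℕ) ∈ B2 N R ↔
      gc (col k t N a) (col k t N b) = true := by
  wlog hab : a ≤ b generalizing a b
  · rw [add_comm, gc_symm]
    exact this b a (le_of_not_ge hab)
  rw [← pos_lt N k t ht a b hab, ← hR]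
  constructor
  · rintro ⟨c, d, hcd, h, he⟩
    obtain ⟨rfl, rfl⟩ := single_pair hab hcd he
    exact h
  · intro h
    exact ⟨a, b, hab, h, rfl⟩

lemma count (k t u N R : ℕ) (hN : N = k + 1 + t + u)
    (hR : R - (N+1) = ∑ j ∈ Finset.range k, (N - j) + (t + 1)) :
    (((E1set N R).ncard : ℚ) + (E2set N R).ncard - (Yset N R).ncard) = pF k (t+1) u := by
  subst hN
  have hB := B2_iff _ R k t (by omega) hR
  have hc := col_card k t u
  rw [E2_card _ hB, E1_eq _ hB, Y_eq _ hB, B2_eq _ hB, ncard_V _ k t u hc, ncard_V _ k t u hc,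
    ncard_VV _ k t u hc, sumE, sumY]
  rw [Nat.cast_mul, sumB, trip_card _ k t u hc]
  simp only [pF, pE2, c2]
  ring

theorem statement11 (n r : ℕ) (hn : 1 ≤ n) (hr1 : n + 1 ≤ r)
    (hr2 : r ≤ (n+1)*(n+2)/2) (c : ℕ)
    (hc : IsLeast {c' : ℕ | r ≤ ∑ j ∈ Finset.range (c'+1), (n+1-j)} c)
    (hE : (Yset n r).ncard ≤ (E1set n r).ncard + (E2set n r).ncard) :
    (Yset (n+1) (r+c)).ncard
      ≤ (E1set (n+1) (r+c)).ncard + (E2set (n+1) (r+c)).ncard := by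
  obtain ⟨h1, h2⟩ := hc
  simp only [Set.mem_ofPred_eq] at h1
  rcases c with _ | k
  · have hr : r = n + 1 := by simp at h1; omega
    have : Yset (n+1) (r+0) = ∅ := by
      ext γ
      simp only [Yset, B2, Set.mem_ofPred_eq, Set.mem_empty_iff_false, iff_false]
      rintro ⟨α, ⟨a, b, -, h, -⟩, -⟩
      omega
    rw [this]
    simp
  · have h3 : ¬ r ≤ ∑ j ∈ Finset.range (k+1), (n+1-j) := by
      intro h
      have := h2 (show k ∈ {c' : ℕ | r ≤ ∑ j ∈ Finset.range (c'+1), (n+1-j)} from h)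
      omega
    have hs : ∑ j ∈ Finset.range (n+1), (n+1-j) = (n+1)*(n+2)/2 := by
      have := Finset.sum_range_reflect (fun j => j + 1) (n+1)
      have e : ∑ j ∈ Finset.range (n+1), (n+1-j) = ∑ j ∈ Finset.range (n+1), (n+1-1-j+1) :=
        Finset.sum_congr rfl fun j hj => by have := Finset.mem_range.1 hj; omega
      rw [e, this]
      have h := Finset.sum_range_id_mul_two (n+2)
      rw [Finset.sum_range_succ'] at h
      simp only [add_zero] at h
      have : n + 2 - 1 = n + 1 := by omega
      rw [this, mul_comm (n+2)] at h
      omega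
    have hkn : k + 1 ≤ n := h2 (show n ∈ {c' : ℕ | r ≤ ∑ j ∈ Finset.range (c'+1), (n+1-j)} from
      (by simp only [Set.mem_ofPred_eq]; rw [hs]; exact hr2))
    have hshift : ∀ x, ∑ j ∈ Finset.range (x+1), (n+1-j) =
        ∑ j ∈ Finset.range x, (n-j) + (n+1) := by
      intro x
      rw [Finset.sum_range_succ']
      simp
    have hplus : ∑ j ∈ Finset.range k, (n+1-j) = ∑ j ∈ Finset.range k, (n-j) + k := by
      have : ∑ j ∈ Finset.range k, (n+1-j) = ∑ j ∈ Finset.range k, ((n-j)+1) :=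
        Finset.sum_congr rfl fun j hj => by have := Finset.mem_range.1 hj; omega
      rw [this, Finset.sum_add_distrib]; simp
    rw [hshift] at h1 h3
    rw [Finset.sum_range_succ] at h1
    obtain ⟨t, ht⟩ : ∃ t, r = ∑ j ∈ Finset.range k, (n-j) + (n+1) + (t+1) :=
      ⟨r - (∑ j ∈ Finset.range k, (n-j) + (n+1)) - 1, by omega⟩
    obtain ⟨u, hu⟩ : ∃ u, n = k + 1 + t + u := ⟨n - (k+1+t), by omega⟩
    have c1 := count k t u n r hu (by omega)
    have c2 := count k t (u+1) (n+1) (r+(k+1)) (by omega) (by omega)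
    have hE' : ((Yset n r).ncard : ℚ) ≤ (E1set n r).ncard + (E2set n r).ncard := by
      exact_mod_cast hE
    have h0 : 0 ≤ pF k (t+1) u := by rw [← c1]; linarith
    have := pF_step k t u (by positivity) (by positivity) (by positivity) h0
    push_cast at c2
    rw [← c2] at this
    have : ((Yset (n+1) (r+(k+1))).ncard : ℚ) ≤
        (E1set (n+1) (r+(k+1))).ncard + (E2set (n+1) (r+(k+1))).ncard := by linarith
    exact_mod_cast this
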